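/- arXiv:1102.0031 — 5 statements merged into one kernel-verified Lean document; each statement's English description precedes it below -/
import Mathlib

section
/- Let Φ be a root system in E and let f, g ∈ F(Φ) be functionals whose Borel sets Φ_f and Φ_g are distinct. Then the following are equivalent: (i) Φ_f ∩ Φ_{−g} spans a one-dimensional subspace of E; (ii) Φ_f and Φ_g are co-maximal; (iii) for every h ∈ F(Φ) with Φ_h ⊇ Φ_f ∩ Φ_g, one has Φ_h ∩ Φ_g = Φ_f ∩ Φ_g or Φ_h ∩ Φ_f = Φ_f ∩ Φ_g. -/
section RootSystemDefs

variable {E : Type*} [AddCommGroup E] [Module ℝ E]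

/-- A root system in a real vector space `E`: a finite subset that spans `E`,
does not contain `0`, and is closed under negation. -/
structure IsRootSystem (Φ : Set E) : Prop where
  finite : Φ.Finite
  spans : Submodule.span ℝ Φ = ⊤
  zero_notMem : (0 : E) ∉ Φ
  neg_mem : ∀ α ∈ Φ, -α ∈ Φ

/-- `f ∈ F(Φ)`: a linear functional not vanishing on any root and taking
distinct values on distinct roots. -/
def IsRegularFunc (Φ : Set E) (f : E →ₗ[ℝ] ℝ) : Prop :=
  (∀ α ∈ Φ, f α ≠ 0) ∧ ∀ α ∈ Φ, ∀ β ∈ Φ, α ≠ β → f α ≠ f β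

/-- The Borel set `Φ_f = {α ∈ Φ | f α > 0}`. -/
def borelSet (Φ : Set E) (f : E →ₗ[ℝ] ℝ) : Set E :=
  {α ∈ Φ | 0 < f α}

/-- A Borel subset of `Φ`. -/
def IsBorelSet (Φ : Set E) (B : Set E) : Prop :=
  ∃ f : E →ₗ[ℝ] ℝ, IsRegularFunc Φ f ∧ B = borelSet Φ f

/-- Two Borel sets `B₁`, `B₂` are co-maximal if every Borel set containing
`B₁ ∩ B₂` equals `B₁` or `B₂`. -/
def CoMaximal (Φ : Set E) (B₁ B₂ : Set E) : Prop :=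
  ∀ B : Set E, IsBorelSet Φ B → B₁ ∩ B₂ ⊆ B → B = B₁ ∨ B = B₂

/-- The boundary of the Borel set `Φ_f`. -/
def borelBoundary (Φ : Set E) (f : E →ₗ[ℝ] ℝ) : Set E :=
  ⋃ B ∈ {B : Set E | IsBorelSet Φ B ∧ CoMaximal Φ (borelSet Φ f) B}, borelSet Φ f \ B

/-- The core of the Borel set `Φ_f`. -/
def borelCore (Φ : Set E) (f : E →ₗ[ℝ] ℝ) : Set E :=
  borelSet Φ f \ borelBoundary Φ f

/-- `Ψ` is a subsystem of `Φ` if `Ψ = Φ ∩ span ℝ Ψ`. -/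
def IsSubsystem (Φ Ψ : Set E) : Prop :=
  Ψ = Φ ∩ (Submodule.span ℝ Ψ : Set E)

/-- Irreducibility of a root system. -/
def IsIrreducibleRS (Φ : Set E) : Prop :=
  ¬ ∃ Φ₁ Φ₂ : Set E, Φ₁.Nonempty ∧ Φ₂.Nonempty ∧ Φ₁ ∪ Φ₂ = Φ ∧ Disjoint Φ₁ Φ₂ ∧
      Submodule.span ℝ Φ₁ ⊓ Submodule.span ℝ Φ₂ = ⊥

/-- The rank of a subset of `E` (the dimension of its span). -/
noncomputable def rankOf (Ψ : Set E) : ℕ := Module.finrank ℝ (Submodule.span ℝ Ψ)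

/-- Regularity of a root system: every root lies in an irreducible rank-2 subsystem. -/
def IsRegularRS (Φ : Set E) : Prop :=
  ∀ α ∈ Φ, ∃ Ψ : Set E, IsSubsystem Φ Ψ ∧ IsIrreducibleRS Ψ ∧ rankOf Ψ = 2 ∧ α ∈ Ψ

end RootSystemDefs

open Filter Topology in
/-- A functional with strict inequalities can be perturbed to a regular one. -/
theorem exists_regular_perturb {E : Type*} [AddCommGroup E] [Module ℝ E]
    (Φ : Set E) (hfin : Φ.Finite) (f k : E →ₗ[ℝ] ℝ) (hf : IsRegularFunc Φ f) :
    ∃ h : E →ₗ[ℝ] ℝ, IsRegularFunc Φ h ∧ ∀ v ∈ Φ, (0 < k v → 0 < h v) ∧ (k v < 0 → h v < 0) := by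
  have hlim : ∀ v, Tendsto (fun ε : ℝ => k v + ε * f v) (𝓝[>] 0) (𝓝 (k v)) := by
    intro v
    have : Continuous (fun ε : ℝ => k v + ε * f v) := by fun_prop
    have h2 := this.tendsto 0
    simp only [zero_mul, add_zero] at h2
    exact h2.mono_left nhdsWithin_le_nhds
  have hne : ∀ v, f v ≠ 0 → ∀ᶠ ε in 𝓝[>] (0 : ℝ), k v + ε * f v ≠ 0 := by
    intro v hv
    by_cases hk : k v = 0
    · filter_upwards [self_mem_nhdsWithin] with ε hε
      have : ε ≠ 0 := ne_of_gt hε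
      simp [hk, hv, this]
    · exact (hlim v).eventually_ne hk
  have h1 : ∀ᶠ ε in 𝓝[>] (0 : ℝ), ∀ v ∈ Φ, k v + ε * f v ≠ 0 :=
    (eventually_all_finite hfin).2 fun v hv => hne v (hf.1 v hv)
  have h2 : ∀ᶠ ε in 𝓝[>] (0 : ℝ), ∀ v ∈ Φ, ∀ w ∈ Φ, v ≠ w →
      k v + ε * f v ≠ k w + ε * f w := by
    refine (eventually_all_finite hfin).2 fun v hv => (eventually_all_finite hfin).2 fun w hw => ?_
    by_cases hvw : v = w
    · simp [hvw]
    · have := hne (v - w) (by rw [map_sub]; exact sub_ne_zero.2 (hf.2 v hv w hw hvw))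
      filter_upwards [this] with ε hε _ h
      apply hε
      simp only [map_sub]
      linarith
  have h3 : ∀ᶠ ε in 𝓝[>] (0 : ℝ), ∀ v ∈ Φ,
      (0 < k v → 0 < k v + ε * f v) ∧ (k v < 0 → k v + ε * f v < 0) := by
    refine (eventually_all_finite hfin).2 fun v hv => ?_
    rcases lt_trichotomy (k v) 0 with h | h | h
    · filter_upwards [(hlim v).eventually_lt_const h] with ε hε
      exact ⟨fun h' => absurd h' h.not_gt, fun _ => hε⟩
    · simp [h]
    · filter_upwards [(hlim v).eventually_const_lt h] with ε hε
      exact ⟨fun _ => hε, fun h' => absurd h' h.not_gt⟩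
  obtain ⟨ε, e1, e2, e3⟩ := (h1.and (h2.and h3)).exists
  refine ⟨k + ε • f, ⟨?_, ?_⟩, ?_⟩
  · simpa using e1
  · simpa using e2
  · simpa using e3

/-- Inclusion of Borel sets implies equality. -/
theorem borelSet_eq_of_subset {E : Type*} [AddCommGroup E] [Module ℝ E]
    (Φ : Set E) (hΦ : IsRootSystem Φ) (f h : E →ₗ[ℝ] ℝ) (hf : IsRegularFunc Φ f)
    (hs : borelSet Φ f ⊆ borelSet Φ h) : borelSet Φ h = borelSet Φ f := by
  refine Set.Subset.antisymm ?_ hs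
  rintro a ⟨ha, hpos⟩
  refine ⟨ha, ?_⟩
  by_contra hn
  have h1 : f a < 0 := lt_of_le_of_ne (not_lt.1 hn) (hf.1 a ha)
  have h2 : -a ∈ borelSet Φ h := hs ⟨hΦ.neg_mem a ha, by simpa using h1⟩
  have h3 := h2.2
  simp only [map_neg] at h3
  linarith

open Filter Topology in
/-- Two non-proportional roots in `Φ_f ∩ Φ_{-g}` can be separated. -/
theorem exists_separating {E : Type*} [AddCommGroup E] [Module ℝ E]
    (Φ : Set E) (hfin : Φ.Finite) (f g : E →ₗ[ℝ] ℝ) (a b : E)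
    (hfa : 0 < f a) (hga : g a < 0) (hfb : 0 < f b)
    (hb : b ∉ Submodule.span ℝ {a}) :
    ∃ k : E →ₗ[ℝ] ℝ, (∀ v ∈ Φ, 0 < f v → 0 < g v → 0 < k v) ∧
      ((0 < k a ∧ k b < 0) ∨ (0 < k b ∧ k a < 0)) := by
  obtain ⟨p, hpb, hpa⟩ := Submodule.exists_le_ker_of_notMem hb
  have hpa : p a = 0 := hpa (Submodule.mem_span_singleton_self a)
  obtain ⟨q, hqa, hqb⟩ : ∃ q : E →ₗ[ℝ] ℝ, 0 < q a ∧ q b < 0 := by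
    have hsq : 0 < p b * p b := mul_self_pos.2 hpb
    have hm := mul_pos hsq hfa
    refine ⟨p b • (p b • f - (f a + f b) • p), ?_, ?_⟩
    · simp [hpa]; nlinarith
    · simp; nlinarith
  set k : E →ₗ[ℝ] ℝ := (-g a) • f + f a • g with hk
  have hka : k a = 0 := by simp [hk]; ring
  have hkpos : ∀ v, 0 < f v → 0 < g v → 0 < k v := by
    intro v h1 h2
    have e1 := mul_pos (neg_pos.2 hga) h1
    have e2 := mul_pos hfa h2
    simp only [hk, LinearMap.add_apply, LinearMap.smul_apply, smul_eq_mul]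
    linarith
  have main : ∀ r : E →ₗ[ℝ] ℝ, ∃ ε : ℝ, 0 < ε ∧ ∀ v ∈ Φ, 0 < f v → 0 < g v →
      0 < k v + ε * r v := by
    intro r
    have h1 : ∀ᶠ ε in 𝓝[>] (0 : ℝ), ∀ v ∈ Φ, 0 < f v → 0 < g v → 0 < k v + ε * r v := by
      refine (eventually_all_finite hfin).2 fun v _ => ?_
      by_cases hv : 0 < f v ∧ 0 < g v
      · have : Continuous (fun ε : ℝ => k v + ε * r v) := by fun_prop
        have h2 := this.tendsto 0
        simp only [zero_mul, add_zero] at h2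
        have h3 := h2.mono_left (nhdsWithin_le_nhds (s := Set.Ioi 0))
        filter_upwards [h3.eventually_const_lt (hkpos v hv.1 hv.2)] with ε hε _ _
        exact hε
      · exact Eventually.of_forall fun ε h1 h2 => absurd ⟨h1, h2⟩ hv
    have h0 : ∀ᶠ ε in 𝓝[>] (0 : ℝ), 0 < ε := self_mem_nhdsWithin
    exact (h0.and h1).exists
  rcases le_or_gt (k b) 0 with hc | hc
  · obtain ⟨ε, h0, h1⟩ := main q
    refine ⟨k + ε • q, by simpa using h1, Or.inl ⟨?_, ?_⟩⟩
    · simp only [LinearMap.add_apply, LinearMap.smul_apply, smul_eq_mul, hka]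
      nlinarith
    · simp only [LinearMap.add_apply, LinearMap.smul_apply, smul_eq_mul]
      nlinarith
  · obtain ⟨ε, h0, h1⟩ := main (-q)
    refine ⟨k + ε • (-q), by simpa using h1, Or.inr ⟨?_, ?_⟩⟩
    · simp only [LinearMap.add_apply, LinearMap.smul_apply, smul_eq_mul, LinearMap.neg_apply]
      nlinarith
    · simp only [LinearMap.add_apply, LinearMap.smul_apply, smul_eq_mul, hka, LinearMap.neg_apply]
      nlinarith

/-- Lemma (co-minimal criterion): for distinct Borel sets `Φ_f`, `Φ_g` the following
are equivalent: (i) `Φ_f ∩ Φ_{-g}` spans a one-dimensional subspace;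
(ii) `Φ_f` and `Φ_g` are co-maximal; (iii) every Borel set `Φ_h ⊇ Φ_f ∩ Φ_g`
satisfies `Φ_h ∩ Φ_g = Φ_f ∩ Φ_g` or `Φ_h ∩ Φ_f = Φ_f ∩ Φ_g`. -/
theorem statement0 {E : Type*} [AddCommGroup E] [Module ℝ E] [FiniteDimensional ℝ E]
    (Φ : Set E) (hΦ : IsRootSystem Φ)
    (f g : E →ₗ[ℝ] ℝ) (hf : IsRegularFunc Φ f) (hg : IsRegularFunc Φ g)
    (hne : borelSet Φ f ≠ borelSet Φ g) :
    (Module.finrank ℝ (Submodule.span ℝ (borelSet Φ f ∩ borelSet Φ (-g))) = 1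
        ↔ CoMaximal Φ (borelSet Φ f) (borelSet Φ g)) ∧
    (CoMaximal Φ (borelSet Φ f) (borelSet Φ g)
        ↔ ∀ h : E →ₗ[ℝ] ℝ, IsRegularFunc Φ h →
            borelSet Φ f ∩ borelSet Φ g ⊆ borelSet Φ h →
            borelSet Φ h ∩ borelSet Φ g = borelSet Φ f ∩ borelSet Φ g ∨
            borelSet Φ h ∩ borelSet Φ f = borelSet Φ f ∩ borelSet Φ g) := by
  set D := borelSet Φ f ∩ borelSet Φ (-g) with hD
  have memD : ∀ v, v ∈ D ↔ v ∈ Φ ∧ 0 < f v ∧ g v < 0 := by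
    intro v
    simp only [hD, borelSet, Set.mem_inter_iff, Set.mem_ofPred_eq, LinearMap.neg_apply, neg_pos]
    tauto
  have hDne : ∃ a, a ∈ D := by
    by_contra hcon
    push Not at hcon
    apply hne
    symm
    apply borelSet_eq_of_subset Φ hΦ f g hf
    rintro v ⟨hv, hpos⟩
    refine ⟨hv, ?_⟩
    by_contra hn
    exact hcon v ((memD v).2 ⟨hv, hpos, lt_of_le_of_ne (not_lt.1 hn) (hg.1 v hv)⟩)
  have h12 : Module.finrank ℝ (Submodule.span ℝ D) = 1 →
      CoMaximal Φ (borelSet Φ f) (borelSet Φ g) := by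
    rintro hr _ ⟨h, hh, rfl⟩ hsub
    obtain ⟨a, ha⟩ := hDne
    obtain ⟨haΦ, hfa, hga⟩ := (memD a).1 ha
    have ha0 : a ≠ 0 := fun h0 => hΦ.zero_notMem (h0 ▸ haΦ)
    have hmul : ∀ v ∈ D, ∃ c : ℝ, 0 < c ∧ v = c • a := by
      intro v hv
      obtain ⟨c, hc⟩ := exists_smul_eq_of_finrank_eq_one hr
        (x := ⟨a, Submodule.subset_span ha⟩) (by simpa [Subtype.ext_iff] using ha0)
        ⟨v, Submodule.subset_span hv⟩
      have hc' : c • a = v := congrArg Subtype.val hc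
      refine ⟨c, ?_, hc'.symm⟩
      have hfv := ((memD v).1 hv).2.1
      rw [← hc', map_smul, smul_eq_mul] at hfv
      exact pos_of_mul_pos_left hfv hfa.le
    rcases lt_or_gt_of_ne (hh.1 a haΦ) with hneg | hpos
    · right
      apply borelSet_eq_of_subset Φ hΦ g h hg
      rintro v ⟨hv, hgv⟩
      rcases lt_or_gt_of_ne (hf.1 v hv) with h1 | h1
      · obtain ⟨c, hc, e⟩ := hmul (-v) ((memD _).2 ⟨hΦ.neg_mem v hv, by simpa using h1,
          by simpa using hgv⟩)
        refine ⟨hv, ?_⟩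
        have e' := congrArg h e
        simp only [map_neg, map_smul, smul_eq_mul] at e'
        nlinarith
      · exact hsub ⟨⟨hv, h1⟩, ⟨hv, hgv⟩⟩
    · left
      apply borelSet_eq_of_subset Φ hΦ f h hf
      rintro v ⟨hv, hfv⟩
      rcases lt_or_gt_of_ne (hg.1 v hv) with h1 | h1
      · obtain ⟨c, hc, e⟩ := hmul v ((memD _).2 ⟨hv, hfv, h1⟩)
        refine ⟨hv, ?_⟩
        rw [e, map_smul, smul_eq_mul]
        positivity
      · exact hsub ⟨⟨hv, hfv⟩, ⟨hv, h1⟩⟩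
  have h23 : CoMaximal Φ (borelSet Φ f) (borelSet Φ g) →
      ∀ h : E →ₗ[ℝ] ℝ, IsRegularFunc Φ h →
            borelSet Φ f ∩ borelSet Φ g ⊆ borelSet Φ h →
            borelSet Φ h ∩ borelSet Φ g = borelSet Φ f ∩ borelSet Φ g ∨
            borelSet Φ h ∩ borelSet Φ f = borelSet Φ f ∩ borelSet Φ g := by
    intro hco h hh hsub
    rcases hco _ ⟨h, hh, rfl⟩ hsub with e | e
    · left; rw [e]
    · right; rw [e, Set.inter_comm]
  have h31 : (∀ h : E →ₗ[ℝ] ℝ, IsRegularFunc Φ h →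
            borelSet Φ f ∩ borelSet Φ g ⊆ borelSet Φ h →
            borelSet Φ h ∩ borelSet Φ g = borelSet Φ f ∩ borelSet Φ g ∨
            borelSet Φ h ∩ borelSet Φ f = borelSet Φ f ∩ borelSet Φ g) →
      Module.finrank ℝ (Submodule.span ℝ D) = 1 := by
    intro H
    have key : ∀ k : E →ₗ[ℝ] ℝ, (∀ v ∈ Φ, 0 < f v → 0 < g v → 0 < k v) →
        ∀ a ∈ D, ∀ b ∈ D, 0 < k a → k b < 0 → False := by
      intro k hk a ha b hb hka hkb
      obtain ⟨haΦ, hfa, hga⟩ := (memD a).1 ha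
      obtain ⟨hbΦ, hfb, hgb⟩ := (memD b).1 hb
      obtain ⟨h, hh, hs⟩ := exists_regular_perturb Φ hΦ.finite f k hf
      rcases H h hh (fun v hv => ⟨hv.1.1, (hs v hv.1.1).1 (hk v hv.1.1 hv.1.2 hv.2.2)⟩) with e | e
      · have hm : -b ∈ borelSet Φ h ∩ borelSet Φ g :=
          ⟨⟨hΦ.neg_mem b hbΦ, by simpa using (hs b hbΦ).2 hkb⟩,
            ⟨hΦ.neg_mem b hbΦ, by simpa using hgb⟩⟩
        rw [e] at hm
        have := hm.1.2
        simp only [map_neg] at this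
        linarith
      · have hm : a ∈ borelSet Φ h ∩ borelSet Φ f := ⟨⟨haΦ, (hs a haΦ).1 hka⟩, ⟨haΦ, hfa⟩⟩
        rw [e] at hm
        have := hm.2.2
        linarith
    obtain ⟨a, ha⟩ := hDne
    obtain ⟨haΦ, hfa, hga⟩ := (memD a).1 ha
    have ha0 : a ≠ 0 := fun h0 => hΦ.zero_notMem (h0 ▸ haΦ)
    have hspan : Submodule.span ℝ D = Submodule.span ℝ {a} := by
      apply le_antisymm
      · rw [Submodule.span_le]
        intro b hb
        by_contra hnb
        obtain ⟨k, hk, h⟩ := exists_separating Φ hΦ.finite f g a b hfa hga ((memD b).1 hb).2.1 hnb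
        rcases h with h | h
        · exact key k hk a ha b hb h.1 h.2
        · exact key k hk b hb a ha h.1 h.2
      · exact Submodule.span_mono (by simpa using ha)
    rw [hspan]
    exact finrank_span_singleton ha0
  exact ⟨⟨h12, fun h => h31 (h23 h)⟩, ⟨h23, fun h => h12 (h31 h)⟩⟩
end

section
/- Let Φ be a root system, f ∈ F(Φ), and let α, β ∈ Φ_f be linearly independent. Then every root of Φ of the form aα + bβ with real numbers a, b > 0 lies in the core C_f of Φ_f. -/
lemma ev_ne (u c : ℝ) (hc : c ≠ 0) :
    ∀ᶠ e in nhdsWithin (0 : ℝ) (Set.Ioi 0), u + e * c ≠ 0 := by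
  by_cases hu : u = 0
  · filter_upwards [self_mem_nhdsWithin] with e he
    have he' : (0 : ℝ) < e := he
    simp [hu, hc, he'.ne']
  · have : Continuous fun e : ℝ => u + e * c := by fun_prop
    have h := this.continuousAt (x := 0)
    exact (h.eventually_ne (by simpa using hu)).filter_mono nhdsWithin_le_nhds

lemma ev_pos (u c : ℝ) (hu : 0 < u) :
    ∀ᶠ e in nhdsWithin (0 : ℝ) (Set.Ioi 0), 0 < u + e * c := by
  have : Continuous fun e : ℝ => u + e * c := by fun_prop
  have h := this.continuousAt (x := 0)
  exact (h.eventually_const_lt (by simpa using hu)).filter_mono nhdsWithin_le_nhds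

lemma exists_functional {E : Type*} [AddCommGroup E] [Module ℝ E] (α β : E)
    (hind : LinearIndependent ℝ ![α, β]) (u v : ℝ) :
    ∃ p : E →ₗ[ℝ] ℝ, p α = u ∧ p β = v := by
  obtain ⟨p, hp⟩ := LinearMap.exists_extend ((Module.Basis.span hind).constr ℝ ![u, v])
  have key : ∀ i, p (![α, β] i) = ![u, v] i := by
    intro i
    have h1 := LinearMap.congr_fun hp (Module.Basis.span hind i)
    rw [Module.Basis.constr_basis] at h1
    rw [← h1, LinearMap.comp_apply, Submodule.subtype_apply, Module.Basis.span_apply]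
  exact ⟨p, by simpa using key 0, by simpa using key 1⟩

lemma ev_regular {E : Type*} [AddCommGroup E] [Module ℝ E] (Φ : Set E) (hfin : Φ.Finite)
    (f : E →ₗ[ℝ] ℝ) (hf : IsRegularFunc Φ f) (h : E →ₗ[ℝ] ℝ) :
    ∀ᶠ e in nhdsWithin (0 : ℝ) (Set.Ioi 0), IsRegularFunc Φ (h + e • f) := by
  have h1 : ∀ᶠ e in nhdsWithin (0 : ℝ) (Set.Ioi 0), ∀ x ∈ Φ, h x + e * f x ≠ 0 :=
    (Filter.eventually_all_finite hfin).2 fun x hx => ev_ne _ _ (hf.1 x hx)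
  have h2 : ∀ᶠ e in nhdsWithin (0 : ℝ) (Set.Ioi 0), ∀ x ∈ Φ, ∀ y ∈ Φ, x ≠ y →
      (h x - h y) + e * (f x - f y) ≠ 0 := by
    refine (Filter.eventually_all_finite hfin).2 fun x hx =>
      (Filter.eventually_all_finite hfin).2 fun y hy => ?_
    by_cases hxy : x = y
    · exact Filter.Eventually.of_forall fun e h => absurd hxy h
    · filter_upwards [ev_ne (h x - h y) (f x - f y) (sub_ne_zero.2 (hf.2 x hx y hy hxy))]
        with e he _ using he
  filter_upwards [h1, h2] with e he1 he2
  refine ⟨fun x hx => by simpa using he1 x hx, fun x hx y hy hxy heq => he2 x hx y hy hxy ?_⟩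
  simp only [LinearMap.add_apply, LinearMap.smul_apply, smul_eq_mul] at heq
  linarith

lemma not_comax {E : Type*} [AddCommGroup E] [Module ℝ E] (Φ : Set E) (hfin : Φ.Finite)
    (f g : E →ₗ[ℝ] ℝ) (hf : IsRegularFunc Φ f)
    (x γ : E) (hx : x ∈ borelSet Φ f) (hγ : γ ∈ borelSet Φ f) (hgγ : g γ < 0)
    (hle : g x + (-g γ / f γ) * f x ≤ 0)
    (p : E →ₗ[ℝ] ℝ) (hpx : p x = -1) (hpγ : p γ = 1)
    (hco : CoMaximal Φ (borelSet Φ f) (borelSet Φ g)) : False := by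
  have hfγ : 0 < f γ := hγ.2
  set s := -g γ / f γ with hs
  have hs0 : 0 < s := div_pos (by linarith) hfγ
  have hsγ : g γ + s * f γ = 0 := by rw [hs]; field_simp; ring
  have hI : (borelSet Φ f ∩ borelSet Φ g).Finite := hfin.subset fun y hy => hy.1.1
  have e1 : ∀ᶠ e in nhdsWithin (0 : ℝ) (Set.Ioi 0), ∀ y ∈ borelSet Φ f ∩ borelSet Φ g,
      0 < (g y + s * f y) + e * p y :=
    (Filter.eventually_all_finite hI).2 fun y hy =>
      ev_pos _ _ (add_pos hy.2.2 (mul_pos hs0 hy.1.2))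
  obtain ⟨e, he, he0⟩ := (e1.and self_mem_nhdsWithin).exists
  have he0 : (0 : ℝ) < e := he0
  let k : E →ₗ[ℝ] ℝ := g + s • f + e • p
  have hk : ∀ y, k y = g y + s * f y + e * p y := fun y => by simp [k]
  have hkx : k x < 0 := by rw [hk, hpx]; linarith
  have hkγ : 0 < k γ := by rw [hk, hpγ]; linarith
  have e2 : ∀ᶠ t in nhdsWithin (0 : ℝ) (Set.Ioi 0), ∀ y ∈ borelSet Φ f ∩ borelSet Φ g,
      0 < k y + t * f y :=
    (Filter.eventually_all_finite hI).2 fun y hy => ev_pos _ _ (by rw [hk]; exact he y hy)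
  obtain ⟨t, ⟨⟨ht1, ht2⟩, ht3⟩, ht4⟩ := (((e2.and (ev_regular Φ hfin f hf k)).and
    (ev_pos (k γ) (f γ) hkγ)).and (ev_pos (-k x) (-f x) (by linarith))).exists
  have hh : ∀ y, (k + t • f) y = k y + t * f y := fun y => by simp
  rcases hco (borelSet Φ (k + t • f)) ⟨_, ht2, rfl⟩
    (fun y hy => ⟨hy.1.1, by rw [hh]; exact ht1 y hy⟩) with h | h
  · have := (h.symm ▸ hx : x ∈ borelSet Φ (k + t • f)).2
    rw [hh] at this
    linarith
  · have h3 : γ ∈ borelSet Φ (k + t • f) := ⟨hγ.1, by rw [hh]; exact ht3⟩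
    rw [h] at h3
    exact absurd h3.2 (by linarith)

/-- Lemma: if `α, β ∈ Φ_f` are linearly independent, then any root of the form
`aα + bβ` with `a, b > 0` lies in the core `C_f`. -/
theorem statement1 {E : Type*} [AddCommGroup E] [Module ℝ E] [FiniteDimensional ℝ E]
    (Φ : Set E) (hΦ : IsRootSystem Φ)
    (f : E →ₗ[ℝ] ℝ) (hf : IsRegularFunc Φ f)
    (α β : E) (hα : α ∈ borelSet Φ f) (hβ : β ∈ borelSet Φ f)
    (hind : LinearIndependent ℝ ![α, β]) :
    ∀ γ ∈ Φ, ∀ a b : ℝ, 0 < a → 0 < b → γ = a • α + b • β → γ ∈ borelCore Φ f := by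
  intro γ hγ a b ha hb hγe
  have hfγ : 0 < f γ := by
    rw [hγe]
    simpa using add_pos (mul_pos ha hα.2) (mul_pos hb hβ.2)
  refine ⟨⟨hγ, hfγ⟩, ?_⟩
  intro hbd
  simp only [borelBoundary, Set.mem_iUnion] at hbd
  obtain ⟨B, ⟨⟨g, hg, rfl⟩, hco⟩, -, hnot⟩ := hbd
  have hgγ : g γ < 0 :=
    lt_of_le_of_ne (not_lt.1 fun h => hnot ⟨hγ, h⟩) (hg.1 γ hγ)
  have hs : g γ + (-g γ / f γ) * f γ = 0 := by field_simp; ring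
  have fe : f γ = a * f α + b * f β := by rw [hγe]; simp
  have ge : g γ = a * g α + b * g β := by rw [hγe]; simp
  by_cases hle : g α + (-g γ / f γ) * f α ≤ 0
  · obtain ⟨p, hp1, hp2⟩ := exists_functional α β hind (-1) ((1 + a) / b)
    refine not_comax Φ hΦ.finite f g hf α γ hα ⟨hγ, hfγ⟩ hgγ hle p hp1 ?_ hco
    rw [hγe]
    simp only [map_add, map_smul, hp1, hp2, smul_eq_mul]
    field_simp
    ring
  · obtain ⟨p, hp1, hp2⟩ := exists_functional α β hind ((1 + b) / a) (-1)
    refine not_comax Φ hΦ.finite f g hf β γ hβ ⟨hγ, hfγ⟩ hgγ ?_ p hp2 ?_ hco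
    · by_contra hc
      push Not at hle hc
      generalize -g γ / f γ = s at *
      have h1 := mul_pos ha hle
      have h2 := mul_pos hb hc
      rw [fe, ge] at hs
      linarith
    · rw [hγe]
      simp only [map_add, map_smul, hp1, hp2, smul_eq_mul]
      field_simp
      ring
end

section
/- Let Φ be a root system in E, let Ψ be a subsystem of Φ, let f ∈ F(Φ), and let f₀ be the restriction of f to span_ℝ(Ψ). Then f₀ ∈ F(Ψ), and the core C_{f₀} of the Borel set Ψ_{f₀} (computed in the root system Ψ) is contained in the core C_f of Φ_f (computed in Φ). -/
open Filter Topology in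
lemma aux_ev (a b : ℝ) : ∀ᶠ δ in 𝓝[>] (0 : ℝ),
    (0 < a → 0 < a + δ * b) ∧ (a < 0 → a + δ * b < 0) ∧ (b ≠ 0 → a + δ * b ≠ 0) := by
  have hc : Tendsto (fun δ : ℝ => a + δ * b) (𝓝[>] 0) (𝓝 a) := by
    have : Continuous (fun δ : ℝ => a + δ * b) := by fun_prop
    have h := (this.tendsto 0).mono_left (nhdsWithin_le_nhds (s := Set.Ioi (0 : ℝ)))
    simpa using h
  rcases lt_trichotomy a 0 with h | h | h
  · filter_upwards [hc.eventually (gt_mem_nhds h)] with δ hδ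
    exact ⟨fun h' => absurd h (not_lt.2 h'.le), fun _ => hδ, fun _ => hδ.ne⟩
  · filter_upwards [self_mem_nhdsWithin] with δ hδ
    have hδ' : (0 : ℝ) < δ := hδ
    subst h
    refine ⟨fun h => absurd h (lt_irrefl _), fun h => absurd h (lt_irrefl _), fun h => ?_⟩
    simpa using ⟨hδ'.ne', h⟩
  · filter_upwards [hc.eventually (lt_mem_nhds h)] with δ hδ
    exact ⟨fun _ => hδ, fun h' => absurd h (not_lt.2 h'.le), fun _ => hδ.ne'⟩

open Filter Topology in
lemma aux_perturb {E : Type*} [AddCommGroup E] [Module ℝ E] (S : Set E) (hS : S.Finite)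
    (h p : E →ₗ[ℝ] ℝ) : ∃ δ : ℝ, 0 < δ ∧ ∀ v ∈ S,
      (0 < h v → 0 < (h + δ • p) v) ∧ (h v < 0 → (h + δ • p) v < 0) ∧
      (p v ≠ 0 → (h + δ • p) v ≠ 0) := by
  have h1 : ∀ᶠ δ in 𝓝[>] (0 : ℝ), ∀ v ∈ S,
      (0 < h v → 0 < (h + δ • p) v) ∧ (h v < 0 → (h + δ • p) v < 0) ∧
      (p v ≠ 0 → (h + δ • p) v ≠ 0) := by
    rw [eventually_all_finite hS]
    intro v _
    simpa using aux_ev (h v) (p v)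
  obtain ⟨δ, h2, h3⟩ := (h1.and self_mem_nhdsWithin).exists
  exact ⟨δ, h3, h2⟩

/-- Any functional can be perturbed to a regular one, keeping nonzero signs on `Φ`. -/
lemma aux_regular {E : Type*} [AddCommGroup E] [Module ℝ E] (Φ : Set E) (hS : Φ.Finite)
    (h f : E →ₗ[ℝ] ℝ) (hf : IsRegularFunc Φ f) : ∃ k : E →ₗ[ℝ] ℝ, IsRegularFunc Φ k ∧
      ∀ v ∈ Φ, (0 < h v → 0 < k v) ∧ (h v < 0 → k v < 0) := by
  obtain ⟨δ, _, h2⟩ := aux_perturb (Φ ∪ Set.image2 (fun a b => a - b) Φ Φ)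
    (hS.union (hS.image2 _ hS)) h f
  refine ⟨h + δ • f, ⟨fun α hα => (h2 α (Or.inl hα)).2.2 (hf.1 α hα), ?_⟩,
    fun v hv => ⟨(h2 v (Or.inl hv)).1, (h2 v (Or.inl hv)).2.1⟩⟩
  intro α hα β hβ hne heq
  refine (h2 (α - β) (Or.inr ⟨α, hα, β, hβ, rfl⟩)).2.2 ?_ ?_
  · rw [map_sub]; exact sub_ne_zero.2 (hf.2 α hα β hβ hne)
  · rw [map_sub]; exact sub_eq_zero.2 heq

/-- Roots separating two co-maximal Borel sets are positively proportional. -/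
lemma aux_prop {E : Type*} [AddCommGroup E] [Module ℝ E] (Φ : Set E) (hS : Φ.Finite)
    (f g : E →ₗ[ℝ] ℝ) (hf : IsRegularFunc Φ f)
    (hc : CoMaximal Φ (borelSet Φ f) (borelSet Φ g)) (α β : E) (hα : α ∈ Φ) (hβ : β ∈ Φ)
    (fα : 0 < f α) (fβ : 0 < f β) (gα : g α < 0) (gβ : g β < 0) :
    ∃ c : ℝ, 0 < c ∧ β = c • α := by
  by_cases hsp : β ∈ Submodule.span ℝ {α}
  · obtain ⟨c, rfl⟩ := Submodule.mem_span_singleton.1 hsp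
    refine ⟨c, ?_, rfl⟩
    rw [map_smul, smul_eq_mul] at fβ
    exact pos_of_mul_pos_left fβ fα.le
  exfalso
  obtain ⟨q, hq, hq'⟩ := Submodule.exists_le_ker_of_notMem hsp
  have hqα : q α = 0 := hq' (Submodule.mem_span_singleton_self α)
  obtain ⟨p, pα, pβ⟩ : ∃ p : E →ₗ[ℝ] ℝ, 0 < p α ∧ p β = -1 := by
    refine ⟨f - ((f β + 1) / q β) • q, ?_, ?_⟩
    · simpa [hqα] using fα
    · simp only [LinearMap.sub_apply, LinearMap.smul_apply, smul_eq_mul]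
      field_simp
      ring
  set h1 : E →ₗ[ℝ] ℝ := f α • g - g α • f with hh1
  have h1α : h1 α = 0 := by simp [hh1]; ring
  have h1pos : ∀ v, 0 < f v → 0 < g v → 0 < h1 v := by
    intro v h h'
    simp only [hh1, LinearMap.sub_apply, LinearMap.smul_apply, smul_eq_mul]
    nlinarith [mul_pos fα h', mul_pos (neg_pos.2 gα) h]
  -- it suffices to separate `α` and `β`
  have key : ∀ k : E →ₗ[ℝ] ℝ, (∀ v ∈ Φ, 0 < f v → 0 < g v → 0 < k v) →
      ¬ (0 < k α ∧ k β < 0) ∧ ¬ (k α < 0 ∧ 0 < k β) := by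
    intro k hk
    obtain ⟨l, hl, hl'⟩ := aux_regular Φ hS k f hf
    have := hc (borelSet Φ l) ⟨l, hl, rfl⟩
      (fun v hv => ⟨hv.1.1, (hl' v hv.1.1).1 (hk v hv.1.1 hv.1.2 hv.2.2)⟩)
    have aux : ∀ x y, x ∈ Φ → y ∈ Φ → 0 < f y → g x < 0 → 0 < k x → k y < 0 → False := by
      intro x y hx hy fy gx kx ky
      rcases this with h | h
      · have : y ∈ borelSet Φ l := by rw [h]; exact ⟨hy, fy⟩
        exact lt_asymm this.2 ((hl' y hy).2 ky)
      · have : x ∈ borelSet Φ g := by rw [← h]; exact ⟨hx, (hl' x hx).1 kx⟩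
        exact lt_asymm this.2 gx
    exact ⟨fun h => aux α β hα hβ fβ gα h.1 h.2, fun h => aux β α hβ hα fα gβ h.2 h.1⟩
  rcases le_total (h1 β) 0 with hb | hb
  · obtain ⟨δ, hδ, h2⟩ := aux_perturb Φ hS h1 p
    refine (key (h1 + δ • p) fun v hv a b => (h2 v hv).1 (h1pos v a b)).1 ⟨?_, ?_⟩
    · simpa [h1α] using mul_pos hδ pα
    · simp only [LinearMap.add_apply, LinearMap.smul_apply, smul_eq_mul, pβ]; linarith
  · obtain ⟨δ, hδ, h2⟩ := aux_perturb Φ hS h1 (-p)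
    refine (key (h1 + δ • (-p)) fun v hv a b => (h2 v hv).1 (h1pos v a b)).2 ⟨?_, ?_⟩
    · simpa [h1α] using mul_pos hδ pα
    · simp only [LinearMap.add_apply, LinearMap.smul_apply, smul_eq_mul, pβ,
        LinearMap.neg_apply]; linarith

/-- Inclusion of Borel sets is equality. -/
lemma aux_eq {E : Type*} [AddCommGroup E] [Module ℝ E] (Ψ : Set E)
    (hneg : ∀ α ∈ Ψ, -α ∈ Ψ) (f h : E →ₗ[ℝ] ℝ) (hf : IsRegularFunc Ψ f)
    (hsub : borelSet Ψ f ⊆ borelSet Ψ h) : borelSet Ψ h = borelSet Ψ f := by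
  refine Set.Subset.antisymm (fun β hβ => ⟨hβ.1, ?_⟩) hsub
  by_contra hn
  have h1 : f β < 0 := lt_of_le_of_ne (not_lt.1 hn) (hf.1 β hβ.1)
  have h2 : -β ∈ borelSet Ψ h := hsub ⟨hneg β hβ.1, by simpa using h1⟩
  have h3 : 0 < h (-β) := h2.2
  rw [map_neg] at h3
  linarith [hβ.2]

/-- Lemma: if `Ψ` is a subsystem of `Φ` and `f ∈ F(Φ)`, then the restriction of `f`
is a regular functional for `Ψ`, and the core of the Borel set of `Ψ` determined by
`f` (computed in the root system `Ψ`) is contained in the core of `Φ_f` (computed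
in `Φ`).  Since every linear functional on `span ℝ Ψ` extends to `E`, regular
functionals for `Ψ` (and hence Borel sets, co-maximality, boundary and core in `Ψ`)
are faithfully represented by ambient functionals `E →ₗ[ℝ] ℝ`. -/
theorem statement2 {E : Type*} [AddCommGroup E] [Module ℝ E] [FiniteDimensional ℝ E]
    (Φ Ψ : Set E) (hΦ : IsRootSystem Φ) (hΨ : IsSubsystem Φ Ψ)
    (f : E →ₗ[ℝ] ℝ) (hf : IsRegularFunc Φ f) :
    IsRegularFunc Ψ f ∧ borelCore Ψ f ⊆ borelCore Φ f := by
  have hsub : Ψ ⊆ Φ := fun x hx => by rw [hΨ] at hx; exact hx.1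
  have hreg : ∀ g : E →ₗ[ℝ] ℝ, IsRegularFunc Φ g → IsRegularFunc Ψ g := fun g hg =>
    ⟨fun α hα => hg.1 α (hsub hα), fun α hα β hβ => hg.2 α (hsub hα) β (hsub hβ)⟩
  have hneg : ∀ α ∈ Ψ, -α ∈ Ψ := by
    intro α hα
    have h1 : -α ∈ Φ ∩ (Submodule.span ℝ Ψ : Set E) :=
      ⟨hΦ.neg_mem α (hsub hα), neg_mem (Submodule.subset_span hα)⟩
    rw [hΨ]; exact h1
  refine ⟨hreg f hf, fun α hα => ⟨⟨hsub hα.1.1, hα.1.2⟩, fun hb => hα.2 ?_⟩⟩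
  simp only [borelBoundary, Set.mem_iUnion] at hb ⊢
  obtain ⟨B, ⟨⟨g, hg, rfl⟩, hc⟩, hαf, hαg⟩ := hb
  have αΨ : α ∈ Ψ := hα.1.1
  have neg_of : ∀ β ∈ Φ, ¬ 0 < g β → g β < 0 := fun β hβ h =>
    lt_of_le_of_ne (not_lt.1 h) (hg.1 β hβ)
  have gα : g α < 0 := neg_of α hαf.1 fun h => hαg ⟨hαf.1, h⟩
  have hprop : ∀ β ∈ Φ, 0 < f β → g β < 0 → ∃ c : ℝ, 0 < c ∧ β = c • α :=
    fun β hβ h h' => aux_prop Φ hΦ.finite f g hf hc α β hαf.1 hβ hαf.2 h gα h'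
  refine ⟨borelSet Ψ g, ⟨⟨g, hreg g hg, rfl⟩, ?_⟩, hα.1, fun h => lt_asymm h.2 gα⟩
  rintro _ ⟨h, hh, rfl⟩ hsup
  rcases lt_or_gt_of_ne (hh.1 α αΨ) with hs | hs
  · right
    refine aux_eq Ψ hneg g h (hreg g hg) fun β hβ => ?_
    by_cases fβ : 0 < f β
    · exact hsup ⟨⟨hβ.1, fβ⟩, hβ⟩
    · have fβ' : f β < 0 := lt_of_le_of_ne (not_lt.1 fβ) (hf.1 β (hsub hβ.1))
      obtain ⟨c, hc0, hcβ⟩ := hprop (-β) (hsub (hneg β hβ.1)) (by simpa using fβ')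
        (by simpa using hβ.2)
      have h1 : h (-β) = c * h α := by rw [hcβ]; simp
      rw [map_neg] at h1
      exact ⟨hβ.1, by nlinarith [mul_neg_of_pos_of_neg hc0 hs]⟩
  · left
    refine aux_eq Ψ hneg f h (hreg f hf) fun β hβ => ?_
    by_cases gβ : 0 < g β
    · exact hsup ⟨hβ, ⟨hβ.1, gβ⟩⟩
    · obtain ⟨c, hc0, hcβ⟩ := hprop β (hsub hβ.1) hβ.2 (neg_of β (hsub hβ.1) gβ)
      have h1 : h β = c * h α := by rw [hcβ]; simp
      exact ⟨hβ.1, by rw [h1]; exact mul_pos hc0 hs⟩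
end

section
/- Let Φ be an irreducible root system of rank 2. Then every root of Φ is contained in the core of some Borel set: for every α ∈ Φ there exists f ∈ F(Φ) with α ∈ C_f. -/
open Filter Topology in
theorem rs_perturb {E : Type*} [AddCommGroup E] [Module ℝ E] [FiniteDimensional ℝ E]
    (Φ : Set E) (hΦ : IsRootSystem Φ) (f0 : E →ₗ[ℝ] ℝ) :
    ∃ h : E →ₗ[ℝ] ℝ, IsRegularFunc Φ h ∧ ∀ v ∈ Φ, 0 < f0 v → 0 < h v := by
  classical
  let S : Set E := Φ ∪ (((fun p : E × E => p.1 - p.2) '' (Φ ×ˢ Φ)) \ {0})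
  have hSf : S.Finite := hΦ.finite.union (((hΦ.finite.prod hΦ.finite).image _).subset Set.diff_subset)
  have hS0 : ∀ v ∈ S, v ≠ 0 := by
    rintro v (hv | hv) rfl
    · exact hΦ.zero_notMem hv
    · exact hv.2 rfl
  obtain ⟨u, hu⟩ : ∃ u : Module.Dual ℝ E, ∀ v ∈ S, u v ≠ 0 := by
    have := hSf.to_subtype
    obtain ⟨u, hu⟩ := Module.exists_dual_forall_apply_ne_zero (K := ℝ) (fun v : S => (v : E))
      (fun v => hS0 v v.2)
    exact ⟨u, fun v hv => hu ⟨v, hv⟩⟩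
  have hlim : ∀ v, Tendsto (fun ε : ℝ => f0 v + ε * u v) (𝓝[>] 0) (𝓝 (f0 v)) := by
    intro v
    have : Continuous (fun ε : ℝ => f0 v + ε * u v) := by fun_prop
    have h2 := this.tendsto 0
    simp only [zero_mul, add_zero] at h2
    exact h2.mono_left nhdsWithin_le_nhds
  have h1 : ∀ᶠ ε in 𝓝[>] (0:ℝ), ∀ v ∈ S, f0 v + ε * u v ≠ 0 := by
    rw [hSf.eventually_all]
    intro v hv
    by_cases h0 : f0 v = 0
    · filter_upwards [self_mem_nhdsWithin] with ε hε
      rw [h0, zero_add]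
      exact mul_ne_zero (ne_of_gt hε) (hu v hv)
    · exact (hlim v).eventually_ne h0
  have h2 : ∀ᶠ ε in 𝓝[>] (0:ℝ), ∀ v ∈ Φ, 0 < f0 v → 0 < f0 v + ε * u v := by
    rw [hΦ.finite.eventually_all]
    intro v hv
    by_cases h0 : 0 < f0 v
    · filter_upwards [(hlim v).eventually_const_lt h0] with ε hε _ using hε
    · exact Eventually.of_forall fun ε h => absurd h h0
  obtain ⟨ε, he1, he2⟩ := (h1.and h2).exists
  refine ⟨f0 + ε • u, ⟨fun v hv => ?_, fun v hv w hw hvw he => ?_⟩, fun v hv h => ?_⟩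
  · simpa using he1 v (Or.inl hv)
  · refine he1 (v - w) (Or.inr ⟨⟨(v, w), ⟨hv, hw⟩, rfl⟩, sub_ne_zero.2 hvw⟩) ?_
    simp only [LinearMap.add_apply, LinearMap.smul_apply, smul_eq_mul] at he
    simp only [map_sub]
    linarith
  · simpa using he2 v hv h

theorem rs_pair {E : Type*} [AddCommGroup E] [Module ℝ E] [FiniteDimensional ℝ E]
    (hrank : Module.finrank ℝ E = 2) (x y : E) (hx : x ≠ 0)
    (hy : y ∉ Submodule.span ℝ {x}) :
    (∀ a b : ℝ, ∃ f : E →ₗ[ℝ] ℝ, f x = a ∧ f y = b) ∧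
    (∀ z : E, ∃ a b : ℝ, z = a • x + b • y) := by
  have hli : LinearIndependent ℝ ![x, y] := by
    rw [LinearIndependent.pair_iff' hx]
    intro a ha
    exact hy (Submodule.mem_span_singleton.2 ⟨a, ha⟩)
  let B := basisOfLinearIndependentOfCardEqFinrank hli (by simp [hrank])
  have hB : (B : Fin 2 → E) = ![x, y] := coe_basisOfLinearIndependentOfCardEqFinrank _ _
  refine ⟨fun a b => ⟨B.constr ℝ ![a, b], ?_, ?_⟩, fun z => ⟨B.repr z 0, B.repr z 1, ?_⟩⟩
  · have := B.constr_basis ℝ ![a, b] 0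
    rw [hB] at this
    simpa using this
  · have := B.constr_basis ℝ ![a, b] 1
    rw [hB] at this
    simpa using this
  · have := B.sum_repr z
    rw [hB] at this
    simpa [Fin.sum_univ_two] using this.symm

/-- if two independent roots lie in `Φ_f \ Φ_g`, then the Borel sets are not co-maximal -/
theorem rs_not_comax {E : Type*} [AddCommGroup E] [Module ℝ E] [FiniteDimensional ℝ E]
    (Φ : Set E) (hΦ : IsRootSystem Φ) (hrank : Module.finrank ℝ E = 2) (f g : E →ₗ[ℝ] ℝ)
    (x y : E) (hxΦ : x ∈ Φ) (hyΦ : y ∈ Φ) (hy : y ∉ Submodule.span ℝ {x})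
    (hfx : 0 < f x) (hfy : 0 < f y) (hgx : g x < 0) (hgy : g y < 0)
    (hco : CoMaximal Φ (borelSet Φ f) (borelSet Φ g)) : False := by
  have hx : x ≠ 0 := fun h => hΦ.zero_notMem (h ▸ hxΦ)
  obtain ⟨hfun, hspan⟩ := rs_pair hrank x y hx hy
  have key : ∃ h0 : E →ₗ[ℝ] ℝ, (∀ v, 0 < f v → 0 < g v → 0 < h0 v) ∧ 
      ((0 < h0 x ∧ h0 y < 0) ∨ (h0 x < 0 ∧ 0 < h0 y)) := by
    rcases lt_trichotomy (f x * g y) (f y * g x) with h | h | h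
    · refine ⟨(-(g x * f y) - (g y * f x)) • f + (2 * (f x * f y)) • g, ?_, Or.inl ?_⟩
      · intro v h1 h2
        have := mul_pos hfx hfy
        have h3 := mul_neg_of_neg_of_pos hgx hfy
        have h4 := mul_neg_of_neg_of_pos hgy hfx
        simp only [LinearMap.add_apply, LinearMap.smul_apply, smul_eq_mul]
        have h5 : 0 < -(g x * f y) - g y * f x := by linarith
        positivity
      · simp only [LinearMap.add_apply, LinearMap.smul_apply, smul_eq_mul]
        constructor <;> nlinarith
    · obtain ⟨h0, h1, h2⟩ := hfun 1 (-1)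
      refine ⟨h0, fun v hv1 hv2 => ?_, Or.inl ⟨by simp [h1], by simp [h2]⟩⟩
      exfalso
      obtain ⟨a, b, rfl⟩ := hspan v
      simp only [map_add, map_smul, smul_eq_mul] at hv1 hv2
      have h3 : f x * (a * g x + b * g y) = g x * (a * f x + b * f y) := by
        linear_combination b * h
      nlinarith [mul_pos hfx hv2, mul_neg_of_neg_of_pos hgx hv1]
    · refine ⟨(-(g x * f y) - (g y * f x)) • f + (2 * (f x * f y)) • g, ?_, Or.inr ?_⟩
      · intro v h1 h2
        have := mul_pos hfx hfy
        have h3 := mul_neg_of_neg_of_pos hgx hfy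
        have h4 := mul_neg_of_neg_of_pos hgy hfx
        simp only [LinearMap.add_apply, LinearMap.smul_apply, smul_eq_mul]
        have h5 : 0 < -(g x * f y) - g y * f x := by linarith
        positivity
      · simp only [LinearMap.add_apply, LinearMap.smul_apply, smul_eq_mul]
        constructor <;> nlinarith
  obtain ⟨h0, hpos, hsep⟩ := key
  obtain ⟨h, hreg, hh⟩ := rs_perturb Φ hΦ h0
  have hneg : ∀ v ∈ Φ, h0 v < 0 → h v < 0 := by
    intro v hv hlt
    have := hh (-v) (hΦ.neg_mem v hv) (by simpa using hlt)
    simpa using this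
  have hc := hco (borelSet Φ h) ⟨h, hreg, rfl⟩
    (fun v hv => ⟨hv.1.1, hh v hv.1.1 (hpos v hv.1.2 hv.2.2)⟩)
  have e1 : borelSet Φ h = borelSet Φ f → 0 < h x ∧ 0 < h y := fun e =>
    ⟨(e.symm ▸ (⟨hxΦ, hfx⟩ : x ∈ borelSet Φ f) : x ∈ borelSet Φ h).2,
     (e.symm ▸ (⟨hyΦ, hfy⟩ : y ∈ borelSet Φ f) : y ∈ borelSet Φ h).2⟩
  have e2 : borelSet Φ h = borelSet Φ g → ¬ 0 < h x ∧ ¬ 0 < h y := fun e =>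
    ⟨fun hp => absurd (e ▸ (⟨hxΦ, hp⟩ : x ∈ borelSet Φ h) : x ∈ borelSet Φ g).2 (by linarith),
     fun hp => absurd (e ▸ (⟨hyΦ, hp⟩ : y ∈ borelSet Φ h) : y ∈ borelSet Φ g).2 (by linarith)⟩
  rcases hsep with ⟨s1, s2⟩ | ⟨s1, s2⟩
  · have a1 := hh x hxΦ s1
    have a2 := hneg y hyΦ s2
    rcases hc with hc | hc
    · linarith [(e1 hc).2]
    · exact (e2 hc).1 a1
  · have a1 := hneg x hxΦ s1
    have a2 := hh y hyΦ s2
    rcases hc with hc | hc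
    · linarith [(e1 hc).1]
    · exact (e2 hc).2 a2

theorem rs_flip {E : Type*} [AddCommGroup E] [Module ℝ E]
    (Φ : Set E) (hΦ : IsRootSystem Φ) (β : E) (hβ : β ∈ Φ) (b : ℝ) (hb : b ≠ 0) :
    ∃ β' ∈ Φ, ∃ b' : ℝ, 0 < b' ∧ b • β = b' • β' ∧
      Submodule.span ℝ {β'} = Submodule.span ℝ {β} := by
  rcases lt_or_gt_of_ne hb with h | h
  · exact ⟨-β, hΦ.neg_mem β hβ, -b, by linarith, by simp, by
      rw [← Set.neg_singleton, Submodule.span_neg]⟩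
  · exact ⟨β, hβ, b, h, rfl, rfl⟩

theorem rs_symm {E : Type*} [AddCommGroup E] [Module ℝ E] (x y : E) (hy0 : y ≠ 0)
    (h : x ∈ Submodule.span ℝ {y}) (hx0 : x ≠ 0) : y ∈ Submodule.span ℝ {x} := by
  obtain ⟨a, rfl⟩ := Submodule.mem_span_singleton.1 h
  have ha : a ≠ 0 := by rintro rfl; simp at hx0
  exact Submodule.mem_span_singleton.2 ⟨a⁻¹, by rw [smul_smul, inv_mul_cancel₀ ha, one_smul]⟩

theorem rs_triple {E : Type*} [AddCommGroup E] [Module ℝ E] [FiniteDimensional ℝ E]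
    (Φ : Set E) (hΦ : IsRootSystem Φ) (hirr : IsIrreducibleRS Φ)
    (hrank : Module.finrank ℝ E = 2) (α : E) (hα : α ∈ Φ) :
    ∃ β ∈ Φ, ∃ γ ∈ Φ, β ∉ Submodule.span ℝ {α} ∧ γ ∉ Submodule.span ℝ {α} ∧
      γ ∉ Submodule.span ℝ {β} := by
  have hα0 : α ≠ 0 := fun h => hΦ.zero_notMem (h ▸ hα)
  obtain ⟨β, hβ, hβα⟩ : ∃ β ∈ Φ, β ∉ Submodule.span ℝ {α} := by
    by_contra! hc
    have h1 : Submodule.span ℝ {α} = ⊤ := top_unique (hΦ.spans ▸ Submodule.span_le.2 hc)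
    have h2 := finrank_span_singleton (K := ℝ) hα0
    rw [h1, finrank_top, hrank] at h2
    omega
  by_contra! hc
  have hinf : Submodule.span ℝ {α} ⊓ Submodule.span ℝ {β} = ⊥ := by
    rw [eq_bot_iff]
    rintro z ⟨h1, h2⟩
    by_contra hz
    have hz : z ≠ 0 := hz
    have hβ0 : β ≠ 0 := fun h => hΦ.zero_notMem (h ▸ hβ)
    have h3 := rs_symm z β hβ0 h2 hz
    exact hβα ((Submodule.span_singleton_le_iff_mem _ _).2 h1 h3)
  refine hirr ⟨Φ ∩ Submodule.span ℝ {α}, Φ ∩ Submodule.span ℝ {β},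
    ⟨α, hα, Submodule.mem_span_singleton_self α⟩, ⟨β, hβ, Submodule.mem_span_singleton_self β⟩,
    ?_, ?_, ?_⟩
  · ext v
    constructor
    · rintro (h | h) <;> exact h.1
    · intro hv
      by_cases h : v ∈ Submodule.span ℝ {α}
      · exact Or.inl ⟨hv, h⟩
      · exact Or.inr ⟨hv, hc β hβ v hv hβα h⟩
  · rw [Set.disjoint_left]
    rintro v ⟨hv, h1⟩ ⟨_, h2⟩
    have : v ∈ Submodule.span ℝ {α} ⊓ Submodule.span ℝ {β} := ⟨h1, h2⟩
    rw [hinf, Submodule.mem_bot] at this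
    exact hΦ.zero_notMem (this ▸ hv)
  · rw [eq_bot_iff, ← hinf]
    exact inf_le_inf (Submodule.span_le.2 Set.inter_subset_right)
      (Submodule.span_le.2 Set.inter_subset_right)

/-- Lemma: every root in an irreducible root system of rank 2 lies in the
core of some Borel set. -/
theorem statement3 {E : Type*} [AddCommGroup E] [Module ℝ E] [FiniteDimensional ℝ E]
    (Φ : Set E) (hΦ : IsRootSystem Φ) (hirr : IsIrreducibleRS Φ)
    (hrank : Module.finrank ℝ E = 2) :
    ∀ α ∈ Φ, ∃ f : E →ₗ[ℝ] ℝ, IsRegularFunc Φ f ∧ α ∈ borelCore Φ f := by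
  intro α hα
  have h0 : ∀ v ∈ Φ, v ≠ 0 := fun v hv h => hΦ.zero_notMem (h ▸ hv)
  obtain ⟨β₀, hβ₀, γ₀, hγ₀, h1, h2, h3⟩ := rs_triple Φ hΦ hirr hrank α hα
  obtain ⟨b₀, c₀, hbc₀⟩ := (rs_pair hrank β₀ γ₀ (h0 _ hβ₀) h3).2 α
  have hb₀ : b₀ ≠ 0 := by
    rintro rfl
    refine h2 (rs_symm α γ₀ (h0 _ hγ₀) ?_ (h0 _ hα))
    exact Submodule.mem_span_singleton.2 ⟨c₀, by simp [hbc₀]⟩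
  have hc₀ : c₀ ≠ 0 := by
    rintro rfl
    refine h1 (rs_symm α β₀ (h0 _ hβ₀) ?_ (h0 _ hα))
    exact Submodule.mem_span_singleton.2 ⟨b₀, by simp [hbc₀]⟩
  obtain ⟨β, hβ, b, hb, hbe, hβs⟩ := rs_flip Φ hΦ β₀ hβ₀ b₀ hb₀
  obtain ⟨γ, hγ, c, hc, hce, hγs⟩ := rs_flip Φ hΦ γ₀ hγ₀ c₀ hc₀
  have hbc : α = b • β + c • γ := by rw [hbc₀, hbe, hce]
  have k1 : β ∉ Submodule.span ℝ {α} := by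
    rwa [← Submodule.span_singleton_le_iff_mem, hβs, Submodule.span_singleton_le_iff_mem]
  have k2 : γ ∉ Submodule.span ℝ {α} := by
    rwa [← Submodule.span_singleton_le_iff_mem, hγs, Submodule.span_singleton_le_iff_mem]
  have k3 : γ ∉ Submodule.span ℝ {β} := by
    rwa [← Submodule.span_singleton_le_iff_mem, hγs, hβs, Submodule.span_singleton_le_iff_mem]
  obtain ⟨f0, hf1, hf2⟩ := (rs_pair hrank β γ (h0 _ hβ) k3).1 1 1
  obtain ⟨f, hreg, hf⟩ := rs_perturb Φ hΦ f0
  have hfβ := hf β hβ (by simp [hf1])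
  have hfγ := hf γ hγ (by simp [hf2])
  have hfα : 0 < f α := by
    rw [hbc]
    simp only [map_add, map_smul, smul_eq_mul]
    positivity
  refine ⟨f, hreg, ⟨hα, hfα⟩, ?_⟩
  intro hbd
  simp only [borelBoundary, Set.mem_iUnion] at hbd
  obtain ⟨B, ⟨⟨g, hg, rfl⟩, hco⟩, -, hαg⟩ := hbd
  have hlt : ∀ v ∈ Φ, ¬ 0 < g v → g v < 0 := fun v hv h =>
    lt_of_le_of_ne (not_lt.1 h) (hg.1 v hv)
  have hgα : g α < 0 := hlt α hα fun h => hαg ⟨hα, h⟩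
  by_cases hgβ : 0 < g β
  · by_cases hgγ : 0 < g γ
    · rw [hbc] at hgα
      simp only [map_add, map_smul, smul_eq_mul] at hgα
      nlinarith [mul_pos hb hgβ, mul_pos hc hgγ]
    · exact rs_not_comax Φ hΦ hrank f g α γ hα hγ k2 hfα hfγ hgα (hlt γ hγ hgγ) hco
  · exact rs_not_comax Φ hΦ hrank f g α β hα hβ k1 hfα hfβ hgα (hlt β hβ hgβ) hco
end

section
/- Let Φ be a regular root system. Then every root of Φ is contained in the core of some Borel set: for every α ∈ Φ there exists f ∈ F(Φ) with α ∈ C_f. -/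
section Aux

variable {E : Type*} [AddCommGroup E] [Module ℝ E]

lemma aux_pert {T : Set E} (hT : T.Finite) (f p : E →ₗ[ℝ] ℝ) :
    ∃ ε : ℝ, 0 < ε ∧ ∀ v ∈ T, (0 < f v → 0 < f v + ε * p v) ∧ (f v < 0 → f v + ε * p v < 0) := by
  have key : ∀ᶠ ε in nhdsWithin (0 : ℝ) (Set.Ioi 0), ∀ v ∈ T,
      (0 < f v → 0 < f v + ε * p v) ∧ (f v < 0 → f v + ε * p v < 0) := by
    rw [Filter.eventually_all_finite hT]
    intro v _
    have ht : Filter.Tendsto (fun ε : ℝ => f v + ε * p v) (nhdsWithin (0 : ℝ) (Set.Ioi 0))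
        (nhds (f v)) := by
      have : ContinuousAt (fun ε : ℝ => f v + ε * p v) 0 := by fun_prop
      have h2 := this.tendsto
      simp only [zero_mul, add_zero] at h2
      exact h2.mono_left nhdsWithin_le_nhds
    refine Filter.Eventually.and ?_ ?_
    · by_cases h : 0 < f v
      · filter_upwards [ht.eventually (lt_mem_nhds h)] with x hx _ using hx
      · exact Filter.Eventually.of_forall fun _ h' => absurd h' h
    · by_cases h : f v < 0
      · filter_upwards [ht.eventually (gt_mem_nhds h)] with x hx _ using hx
      · exact Filter.Eventually.of_forall fun _ h' => absurd h' h
  obtain ⟨ε, h1, h2⟩ := (key.and self_mem_nhdsWithin).exists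
  exact ⟨ε, h2, h1⟩

lemma aux_reg {Φ : Set E} (hΦ : IsRootSystem Φ) (f₀ : E →ₗ[ℝ] ℝ) :
    ∃ f : E →ₗ[ℝ] ℝ, IsRegularFunc Φ f ∧
      ∀ v ∈ Φ, (0 < f₀ v → 0 < f v) ∧ (f₀ v < 0 → f v < 0) := by
  set T : Set E := (Φ ∪ (fun x : E × E => x.1 - x.2) '' (Φ ×ˢ Φ)) \ {0} with hTdef
  have hT : T.Finite := (hΦ.finite.union ((hΦ.finite.prod hΦ.finite).image _)).sdiff
  have : Finite T := hT
  obtain ⟨q, hq⟩ := Module.exists_dual_forall_apply_ne_zero (K := ℝ) (fun v : T => (v : E))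
    (fun v => v.2.2)
  obtain ⟨ε, hε, h⟩ := aux_pert hT f₀ q
  have hne : ∀ v ∈ T, (f₀ + ε • q) v ≠ 0 := by
    intro v hv
    have hqv : q v ≠ 0 := hq ⟨v, hv⟩
    simp only [LinearMap.add_apply, LinearMap.smul_apply, smul_eq_mul]
    rcases lt_trichotomy (f₀ v) 0 with h0 | h0 | h0
    · exact ((h v hv).2 h0).ne
    · rw [h0, zero_add]; exact mul_ne_zero hε.ne' hqv
    · exact ((h v hv).1 h0).ne'
  have hΦT : ∀ v ∈ Φ, v ∈ T := fun v hv =>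
    ⟨Or.inl hv, fun h0 => hΦ.zero_notMem (by rw [Set.mem_singleton_iff] at h0; rwa [← h0])⟩
  refine ⟨f₀ + ε • q, ⟨fun v hv => hne v (hΦT v hv), ?_⟩, ?_⟩
  · intro v hv w hw hvw heq
    refine hne (v - w) ⟨Or.inr ⟨(v, w), ⟨hv, hw⟩, rfl⟩, ?_⟩ ?_
    · simpa [sub_eq_zero] using hvw
    · rw [map_sub, heq, sub_self]
  · intro v hv
    simpa using h v (hΦT v hv)

/-- Prescribing a functional on two independent vectors. -/
lemma aux_dual {α β : E} (hα : α ≠ 0) (hβ : β ∉ Submodule.span ℝ {α}) (x y : ℝ) :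
    ∃ p : E →ₗ[ℝ] ℝ, p α = x ∧ p β = y := by
  have hα' : α ∉ Submodule.span ℝ {β} := by
    intro h
    obtain ⟨c, hc⟩ := Submodule.mem_span_singleton.1 h
    have hc0 : c ≠ 0 := by rintro rfl; exact hα (by rw [← hc, zero_smul])
    refine hβ (Submodule.mem_span_singleton.2 ⟨c⁻¹, ?_⟩)
    rw [← hc, smul_smul, inv_mul_cancel₀ hc0, one_smul]
  obtain ⟨p, hp, hp'⟩ := Submodule.exists_le_ker_of_notMem hβ
  obtain ⟨q, hq, hq'⟩ := Submodule.exists_le_ker_of_notMem hα'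
  have h1 : p α = 0 := hp' (Submodule.mem_span_singleton_self α)
  have h2 : q β = 0 := hq' (Submodule.mem_span_singleton_self β)
  refine ⟨(x / q α) • q + (y / p β) • p, ?_, ?_⟩
  · simp [h1, hq]
  · simp [h2, hp]

lemma aux_flip {Φ : Set E} (hΦ : IsRootSystem Φ) {β : E} (hβ : β ∈ Φ) {x : ℝ} (hx : x ≠ 0) :
    ∃ β' ∈ Φ, ∃ a s : ℝ, 0 < a ∧ s ≠ 0 ∧ x • β = a • β' ∧ β' = s • β := by
  rcases lt_or_gt_of_ne hx with h | h
  · exact ⟨-β, hΦ.neg_mem _ hβ, -x, -1, by linarith, by norm_num, by simp, by simp⟩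
  · exact ⟨β, hβ, x, 1, h, by norm_num, rfl, by simp⟩

lemma aux_three [FiniteDimensional ℝ E] {Φ : Set E} (hΦ : IsRootSystem Φ) (hreg : IsRegularRS Φ)
    {α : E} (hα : α ∈ Φ) :
    ∃ β ∈ Φ, ∃ γ ∈ Φ, ∃ a b : ℝ, 0 < a ∧ 0 < b ∧ α = a • β + b • γ ∧
      ∀ x y : ℝ, ∃ p : E →ₗ[ℝ] ℝ, p β = x ∧ p γ = y := by
  obtain ⟨Ψ, hsub, hirr, hrk, hαΨ⟩ := hreg α hα
  have hΨΦ : ∀ v ∈ Ψ, v ∈ Φ := fun v hv => by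
    rw [hsub] at hv; exact hv.1
  have hα0 : α ≠ 0 := fun h => hΦ.zero_notMem (h ▸ hα)
  have hβex : ∃ β ∈ Ψ, β ∉ Submodule.span ℝ {α} := by
    by_contra! hcon
    have hle : Submodule.span ℝ Ψ ≤ Submodule.span ℝ {α} := Submodule.span_le.2 hcon
    have h1 := Submodule.finrank_mono hle
    rw [finrank_span_singleton hα0] at h1
    unfold rankOf at hrk
    omega
  obtain ⟨β, hβΨ, hβ⟩ := hβex
  have hdisj : Submodule.span ℝ {α} ⊓ Submodule.span ℝ {β} = ⊥ := by
    rw [eq_bot_iff]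
    rintro v ⟨h1, h2⟩
    obtain ⟨c, rfl⟩ := Submodule.mem_span_singleton.1 h1
    obtain ⟨d, hd⟩ := Submodule.mem_span_singleton.1 h2
    obtain ⟨p, hp, hp'⟩ := aux_dual hα0 hβ 1 0
    have := congrArg p hd
    simp only [map_smul, hp, hp', smul_eq_mul, mul_zero, mul_one] at this
    simp [← this]
  have hγex : ∃ γ ∈ Ψ, γ ∉ Submodule.span ℝ {α} ∧ γ ∉ Submodule.span ℝ {β} := by
    by_contra! hcon
    have hle : Submodule.span ℝ (Ψ ∩ Submodule.span ℝ {α}) ⊓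
        Submodule.span ℝ (Ψ ∩ Submodule.span ℝ {β}) = ⊥ := by
      rw [eq_bot_iff, ← hdisj]
      exact inf_le_inf (Submodule.span_le.2 Set.inter_subset_right)
        (Submodule.span_le.2 Set.inter_subset_right)
    refine hirr ⟨Ψ ∩ Submodule.span ℝ {α}, Ψ ∩ Submodule.span ℝ {β},
      ⟨α, hαΨ, Submodule.mem_span_singleton_self α⟩,
      ⟨β, hβΨ, Submodule.mem_span_singleton_self β⟩, ?_, ?_, hle⟩
    · ext v
      constructor
      · rintro (h | h)
        · exact h.1
        · exact h.1
      · intro hv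
        by_cases h : v ∈ Submodule.span ℝ {α}
        · exact Or.inl ⟨hv, h⟩
        · exact Or.inr ⟨hv, hcon v hv h⟩
    · rw [Set.disjoint_left]
      rintro v ⟨hv, h1⟩ ⟨_, h2⟩
      have : v ∈ Submodule.span ℝ {α} ⊓ Submodule.span ℝ {β} := ⟨h1, h2⟩
      rw [hdisj, Submodule.mem_bot] at this
      exact hΦ.zero_notMem (this ▸ hΨΦ v hv)
  obtain ⟨γ, hγΨ, hγα, hγβ⟩ := hγex
  have hspan : Submodule.span ℝ {α, β} = Submodule.span ℝ Ψ := by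
    apply Submodule.eq_of_le_of_finrank_le
    · apply Submodule.span_mono
      rintro v (rfl | rfl)
      · exact hαΨ
      · exact hβΨ
    · have hli : LinearIndependent ℝ ![α, β] := by
        rw [LinearIndependent.pair_iff' hα0]
        intro a ha
        exact hβ (Submodule.mem_span_singleton.2 ⟨a, ha⟩)
      have h1 := finrank_span_eq_card hli
      have h2 : Set.range ![α, β] = {α, β} := by simp [Set.pair_comm]
      rw [h2, Fintype.card_fin] at h1
      unfold rankOf at hrk
      omega
  have hγs : γ ∈ Submodule.span ℝ {α, β} := hspan ▸ Submodule.subset_span hγΨ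
  obtain ⟨x, y, hxy⟩ := Submodule.mem_span_pair.1 hγs
  have hx : x ≠ 0 := by
    rintro rfl
    exact hγβ (Submodule.mem_span_singleton.2 ⟨y, by simpa using hxy⟩)
  have hy : y ≠ 0 := by
    rintro rfl
    exact hγα (Submodule.mem_span_singleton.2 ⟨x, by simpa using hxy⟩)
  have hαeq : α = (-(y / x)) • β + x⁻¹ • γ := by
    rw [← hxy, smul_add, smul_smul, smul_smul, inv_mul_cancel₀ hx, one_smul, neg_smul,
      div_eq_inv_mul]
    abel
  obtain ⟨β', hβ', a, s, ha, hs, e1, e2⟩ :=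
    aux_flip hΦ (hΨΦ β hβΨ) (x := -(y / x)) (neg_ne_zero.2 (div_ne_zero hy hx))
  obtain ⟨γ', hγ', b, t, hb, ht, e3, e4⟩ := aux_flip hΦ (hΨΦ γ hγΨ) (inv_ne_zero hx)
  refine ⟨β', hβ', γ', hγ', a, b, ha, hb, by rw [← e1, ← e3]; exact hαeq, ?_⟩
  intro u w
  obtain ⟨p, hp, hp'⟩ := aux_dual hα0 hβ ((w / t - y * (u / s)) / x) (u / s)
  refine ⟨p, ?_, ?_⟩
  · rw [e2, map_smul, hp', smul_eq_mul]; field_simp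
  · rw [e4, ← hxy, map_smul, map_add, map_smul, map_smul, hp, hp']
    simp only [smul_eq_mul]
    field_simp
    ring

/-- A separating functional contradicts co-maximality. -/
lemma aux_sep {Φ : Set E} (hΦ : IsRootSystem Φ) {f g h₀ p : E →ₗ[ℝ] ℝ}
    (hco : CoMaximal Φ (borelSet Φ f) (borelSet Φ g))
    (hpos : ∀ v ∈ Φ, 0 < f v → 0 < g v → 0 < h₀ v)
    {δ η : E} (hδ : δ ∈ Φ) (hη : η ∈ Φ) (hfδ : 0 < f δ) (hgη : g η < 0)
    (h1 : h₀ δ < 0 ∨ h₀ δ = 0 ∧ p δ < 0) (h2 : 0 < h₀ η ∨ h₀ η = 0 ∧ 0 < p η) : False := by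
  obtain ⟨ε, hε, hp⟩ := aux_pert hΦ.finite h₀ p
  obtain ⟨h, hreg, hh⟩ := aux_reg hΦ (h₀ + ε • p)
  simp only [LinearMap.add_apply, LinearMap.smul_apply, smul_eq_mul] at hh
  have hhδ : h δ < 0 := by
    apply (hh δ hδ).2
    rcases h1 with h1 | ⟨h1, h1'⟩
    · exact (hp δ hδ).2 h1
    · rw [h1, zero_add]; exact mul_neg_of_pos_of_neg hε h1'
  have hhη : 0 < h η := by
    apply (hh η hη).1
    rcases h2 with h2 | ⟨h2, h2'⟩
    · exact (hp η hη).1 h2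
    · rw [h2, zero_add]; exact mul_pos hε h2'
  rcases hco (borelSet Φ h) ⟨h, hreg, rfl⟩ (fun v hv => ⟨hv.1.1,
    (hh v hv.1.1).1 ((hp v hv.1.1).1 (hpos v hv.1.1 hv.1.2 hv.2.2))⟩) with e | e
  · have : δ ∈ borelSet Φ h := by rw [e]; exact ⟨hδ, hfδ⟩
    exact absurd this.2 hhδ.not_gt
  · have : η ∈ borelSet Φ g := by rw [← e]; exact ⟨hη, hhη⟩
    exact absurd this.2 hgη.not_gt

lemma aux_main {Φ : Set E} (hΦ : IsRootSystem Φ) {f g : E →ₗ[ℝ] ℝ}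
    (hco : CoMaximal Φ (borelSet Φ f) (borelSet Φ g))
    {α β γ : E} (hα : α ∈ Φ) (hβ : β ∈ Φ) (hγ : γ ∈ Φ) {a b : ℝ} (hb : 0 < b)
    (he : α = a • β + b • γ)
    (hp : ∃ p : E →ₗ[ℝ] ℝ, p β = 1 ∧ p γ = -1)
    (hfα : 0 < f α) (hfβ : 0 < f β) (hfγ : 0 < f γ) (hgα : g α < 0) (hgβ : g β < 0) : False := by
  set h₀ : E →ₗ[ℝ] ℝ := (-g β) • f + f β • g with hh₀
  have hpos : ∀ v ∈ Φ, 0 < f v → 0 < g v → 0 < h₀ v := by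
    intro v _ h1 h2
    have h3 := mul_pos (neg_pos.2 hgβ) h1
    have h4 := mul_pos hfβ h2
    simp only [hh₀, LinearMap.add_apply, LinearMap.smul_apply, smul_eq_mul]
    linarith
  have h0β : h₀ β = 0 := by
    simp only [hh₀, LinearMap.add_apply, LinearMap.smul_apply, smul_eq_mul]
    ring
  have h0α : h₀ α = b * h₀ γ := by
    rw [he, map_add, map_smul, map_smul, h0β]; simp
  rcases lt_trichotomy (h₀ γ) 0 with h | h | h
  · exact aux_sep hΦ (p := f) hco hpos hα hβ hfα hgβ
      (Or.inl (by rw [h0α]; exact mul_neg_of_pos_of_neg hb h)) (Or.inr ⟨h0β, hfβ⟩)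
  · obtain ⟨p, hp1, hp2⟩ := hp
    exact aux_sep hΦ (p := p) hco hpos hγ hβ hfγ hgβ
      (Or.inr ⟨h, by rw [hp2]; norm_num⟩) (Or.inr ⟨h0β, by rw [hp1]; norm_num⟩)
  · exact aux_sep hΦ (p := g) hco hpos hβ hα hfβ hgα
      (Or.inr ⟨h0β, hgβ⟩) (Or.inl (by rw [h0α]; exact mul_pos hb h))

end Aux

/-- Corollary: every root in a regular root system lies in the core of some Borel set. -/
theorem statement4 {E : Type*} [AddCommGroup E] [Module ℝ E] [FiniteDimensional ℝ E]
    (Φ : Set E) (hΦ : IsRootSystem Φ) (hreg : IsRegularRS Φ) :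
    ∀ α ∈ Φ, ∃ f : E →ₗ[ℝ] ℝ, IsRegularFunc Φ f ∧ α ∈ borelCore Φ f := by
  intro α hα
  obtain ⟨β, hβ, γ, hγ, a, b, ha, hb, he, hp⟩ := aux_three hΦ hreg hα
  obtain ⟨f₀, h1, h2⟩ := hp 1 1
  obtain ⟨f, hf, hs⟩ := aux_reg hΦ f₀
  have hfβ : 0 < f β := (hs β hβ).1 (by rw [h1]; norm_num)
  have hfγ : 0 < f γ := (hs γ hγ).1 (by rw [h2]; norm_num)
  have hfα : 0 < f α := by
    rw [he, map_add, map_smul, map_smul, smul_eq_mul, smul_eq_mul]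
    positivity
  refine ⟨f, hf, ⟨hα, hfα⟩, ?_⟩
  intro hmem
  simp only [borelBoundary, Set.mem_iUnion] at hmem
  obtain ⟨B, ⟨⟨g, hg, rfl⟩, hco⟩, _, hnot⟩ := hmem
  have hgα : g α < 0 := lt_of_le_of_ne (not_lt.1 fun h => hnot ⟨hα, h⟩) (hg.1 α hα)
  by_cases hgβ : g β < 0
  · exact aux_main hΦ hco hα hβ hγ hb he (hp 1 (-1)) hfα hfβ hfγ hgα hgβ
  · have hgγ : g γ < 0 := by
      by_contra hcon
      have e : g α = a * g β + b * g γ := by rw [he]; simp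
      have := mul_nonneg ha.le (not_lt.1 hgβ)
      have := mul_nonneg hb.le (not_lt.1 hcon)
      linarith
    obtain ⟨p, hp1, hp2⟩ := hp (-1) 1
    exact aux_main hΦ hco hα hγ hβ ha (by rw [he, add_comm]) ⟨p, hp2, hp1⟩
      hfα hfγ hfβ hgα hgγ
end
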